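/- arXiv:1910.14527 — 2 statements merged into one kernel-verified Lean document; each statement's English description precedes it below -/
import Mathlib

section
/- Let d be a positive integer and let Ω ⊆ ℝ^d be a locally compact set with nonempty interior. Then for a typical function f ∈ C(Ω), the set {x ∈ Ω : lip f(x) = ∞} has non-σ-finite (d−1)-dimensional Hausdorff measure H^{d−1}. -/
open Filter Set Topology MeasureTheory
open scoped ENNReal NNReal

noncomputable section

/-- A gauge: nondecreasing on `[0,∞)`, right-continuous, `φ 0 = 0`, positive on `(0,∞)`. -/
def IsGauge (φ : ℝ → ℝ) : Prop :=
  (∀ ⦃a b : ℝ⦄, 0 ≤ a → a ≤ b → φ a ≤ φ b) ∧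
  (∀ a : ℝ, 0 ≤ a → ContinuousWithinAt φ (Set.Ici a) a) ∧
  φ 0 = 0 ∧ (∀ r : ℝ, 0 < r → 0 < φ r)

/-- `N_δ(E)`: the least number of sets of diameter at most `δ` needed to cover `E`. -/
def coverNum {X : Type*} [PseudoMetricSpace X] (δ : ℝ) (E : Set X) : ℝ≥0∞ :=
  ⨅ (n : ℕ) (_ : ∃ F : Fin n → Set X,
    (∀ i, EMetric.diam (F i) ≤ ENNReal.ofReal δ) ∧ E ⊆ ⋃ i, F i), (n : ℝ≥0∞)

/-- `ν_0^ζ(E) = liminf_{δ→0+} N_δ(E)·ζ(δ)`. -/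
def nu0 {X : Type*} [PseudoMetricSpace X] (ζ : ℝ → ℝ) (E : Set X) : ℝ≥0∞ :=
  Filter.liminf (fun δ : ℝ => coverNum δ E * ENNReal.ofReal (ζ δ)) (𝓝[>] (0:ℝ))

/-- The lower box-counting measure `ν^ζ`. -/
def lowerBoxMeasure {X : Type*} [PseudoMetricSpace X] (ζ : ℝ → ℝ) (E : Set X) : ℝ≥0∞ :=
  ⨅ (G : ℕ → Set X) (_ : E ⊆ ⋃ n, G n), ∑' n, nu0 ζ (G n)

/-- The lower box dimension `lbdim E = liminf_{r→0+} log N_r(E)/|log r|`. -/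
def lbdim {X : Type*} [PseudoMetricSpace X] (E : Set X) : EReal :=
  Filter.liminf (fun r : ℝ => ENNReal.log (coverNum r E) * ((|Real.log r|⁻¹ : ℝ) : EReal))
    (𝓝[>] (0:ℝ))

/-- The lower packing dimension. -/
def lpdim {X : Type*} [PseudoMetricSpace X] (E : Set X) : EReal :=
  ⨅ (G : ℕ → Set X) (_ : E ⊆ ⋃ n, G n), ⨆ n, lbdim (G n)

/-- The generalized lower scaled oscillation `lip_φ f`. -/
def lipGauge {X : Type*} [PseudoMetricSpace X] (φ : ℝ → ℝ) (f : X → ℝ) (x : X) : ℝ≥0∞ :=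
  Filter.liminf
    (fun r : ℝ => EMetric.diam (f '' Metric.closedBall x r) / ENNReal.ofReal (φ r))
    (𝓝[>] (0:ℝ))

/-- The upper scaled oscillation `Lip f`. -/
def LipGauge {X : Type*} [PseudoMetricSpace X] (φ : ℝ → ℝ) (f : X → ℝ) (x : X) : ℝ≥0∞ :=
  Filter.limsup
    (fun r : ℝ => EMetric.diam (f '' Metric.closedBall x r) / ENNReal.ofReal (φ r))
    (𝓝[>] (0:ℝ))

/-- The Hausdorff measure with gauge `ξ`. -/
def hausdorffGauge {X : Type*} [PseudoMetricSpace X] (ξ : ℝ → ℝ) (E : Set X) : ℝ≥0∞ :=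
  ⨆ (δ : ℝ) (_ : 0 < δ), ⨅ (G : ℕ → Set X) (_ : E ⊆ ⋃ n, G n)
    (_ : ∀ n, EMetric.diam (G n) ≤ ENNReal.ofReal δ),
    ∑' n, ENNReal.ofReal (ξ (EMetric.diam (G n)).toReal)

/-- A box in `ℝ^k`. -/
def IsBox {k : ℕ} (S : Set (EuclideanSpace ℝ (Fin k))) : Prop :=
  ∃ a b : Fin k → ℝ, S = {x | ∀ i, x i ∈ Set.Icc (a i) (b i)}

/-- A microscopic subset of `ℝ^k`. -/
def Microscopic {k : ℕ} (X : Set (EuclideanSpace ℝ (Fin k))) : Prop :=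
  ∀ ε : ℝ, 0 < ε → ∃ B : ℕ → Set (EuclideanSpace ℝ (Fin k)),
    (∀ n, IsBox (B n)) ∧ X ⊆ ⋃ n, B n ∧
    ∀ n, MeasureTheory.volume (B n) ≤ ENNReal.ofReal (ε ^ (n + 1))

/-- A microscopic subset of `ℝ`. -/
def MicroscopicR (E : Set ℝ) : Prop :=
  ∀ ε : ℝ, 0 < ε → ∃ I : ℕ → ℝ × ℝ,
    E ⊆ ⋃ n, Set.Icc (I n).1 (I n).2 ∧
    ∀ n, MeasureTheory.volume (Set.Icc (I n).1 (I n).2) ≤ ENNReal.ofReal (ε ^ (n + 1))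

end

theorem volume_image_le_of_frequently {u : ℝ → ℝ} {A I : Set ℝ} (M : ℝ≥0) (hAI : A ⊆ I)
    (h : ∀ t ∈ A, ∃ᶠ r in 𝓝[>] (0 : ℝ), ∀ s ∈ I, |s - t| ≤ r → |u s - u t| ≤ M * r) :
    volume (u '' A) ≤ M * volume A := by
  have key : ∀ ε : ℝ≥0, 0 < ε → volume (u '' A) ≤ M * (volume A + ε) := by
    intro ε hε
    obtain ⟨T, r, hTc, hTA, hr, hcov, hsum⟩ :=
      Besicovitch.exists_closedBall_covering_tsum_measure_le (volume : Measure ℝ)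
        (ε := ε) (by simpa using hε.ne')
        (fun t => {r : ℝ | 0 < r ∧ ∀ s ∈ I, |s - t| ≤ r → |u s - u t| ≤ M * r}) A
        (by
          intro t ht δ hδ
          have h1 : ∀ᶠ r in 𝓝[>] (0 : ℝ), r ∈ Ioo 0 δ := Ioo_mem_nhdsGT hδ
          obtain ⟨r, hr, hr'⟩ := ((h t ht).and_eventually h1).exists
          exact ⟨r, ⟨hr'.1, hr⟩, hr'⟩)
    have hsub : u '' A ⊆ ⋃ x ∈ T, Metric.closedBall (u x) (M * r x) := by
      rintro _ ⟨a, ha, rfl⟩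
      obtain ⟨x, hx, hax⟩ := mem_iUnion₂.1 (hcov ha)
      refine mem_iUnion₂.2 ⟨x, hx, ?_⟩
      rw [Metric.mem_closedBall, Real.dist_eq] at hax ⊢
      exact (hr x hx).2 a (hAI ha) hax
    have : Countable T := hTc.to_subtype
    calc volume (u '' A) ≤ volume (⋃ x ∈ T, Metric.closedBall (u x) (M * r x)) :=
          measure_mono hsub
      _ ≤ ∑' x : T, volume (Metric.closedBall (u x) (M * r x)) := measure_biUnion_le _ hTc _
      _ = ∑' x : T, M * volume (Metric.closedBall (x : ℝ) (r x)) := by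
          congr 1
          ext x
          rw [Real.volume_closedBall, Real.volume_closedBall, mul_left_comm,
            ENNReal.ofReal_mul M.coe_nonneg, ENNReal.ofReal_coe_nnreal]
      _ = M * ∑' x : T, volume (Metric.closedBall (x : ℝ) (r x)) := ENNReal.tsum_mul_left
      _ ≤ M * (volume A + ε) := by gcongr
  have ht : Tendsto (fun ε : ℝ≥0 => (M : ℝ≥0∞) * (volume A + ε)) (𝓝[>] 0)
      (𝓝 (M * (volume A + (0 : ℝ≥0)))) := by
    refine Tendsto.mono_left ?_ nhdsWithin_le_nhds
    refine ENNReal.Tendsto.const_mul ?_ (Or.inr ENNReal.coe_ne_top)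
    exact tendsto_const_nhds.add (ENNReal.tendsto_coe.2 tendsto_id)
  rw [ENNReal.coe_zero, add_zero] at ht
  exact ge_of_tendsto ht (eventually_nhdsWithin_of_forall fun ε hε => key ε hε)

theorem eq_endpoints_of_frequently {u : ℝ → ℝ} {c : ℝ} (hc : 0 ≤ c)
    (hu : ContinuousOn u (Icc 0 c)) {N E : Set ℝ} (hN : volume N = 0) (hE : E.Countable)
    (hfin : ∀ t ∈ Icc 0 c \ E, ∃ M : ℕ, ∃ᶠ r in 𝓝[>] (0 : ℝ),
      ∀ s ∈ Icc 0 c, |s - t| ≤ r → |u s - u t| ≤ M * r)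
    (hzero : ∀ t ∈ Icc 0 c \ N, ∀ M : ℝ≥0, 0 < M → ∃ᶠ r in 𝓝[>] (0 : ℝ),
      ∀ s ∈ Icc 0 c, |s - t| ≤ r → |u s - u t| ≤ M * r) :
    u 0 = u c := by
  have h1 : volume (u '' (Icc 0 c \ N)) = 0 := by
    have hb : ∀ M : ℝ≥0, 0 < M → volume (u '' (Icc 0 c \ N)) ≤ M * volume (Icc 0 c) := by
      intro M hM
      refine (volume_image_le_of_frequently M sdiff_subset fun t ht => hzero t ht M hM).trans ?_
      gcongr
      exact sdiff_subset
    have ht : Tendsto (fun M : ℝ≥0 => (M : ℝ≥0∞) * volume (Icc 0 c)) (𝓝[>] 0)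
        (𝓝 ((0 : ℝ≥0) * volume (Icc 0 c))) := by
      refine Tendsto.mono_left ?_ nhdsWithin_le_nhds
      refine ENNReal.Tendsto.mul_const (ENNReal.tendsto_coe.2 tendsto_id) (Or.inr ?_)
      simp
    rw [ENNReal.coe_zero, zero_mul] at ht
    exact le_antisymm
      (ge_of_tendsto ht (eventually_nhdsWithin_of_forall fun ε hε => hb ε hε)) zero_le
  have h2 : volume (u '' E) = 0 := (hE.image u).measure_zero _
  have h3 : ∀ M : ℕ, volume (u '' {t ∈ Icc 0 c ∩ N | ∃ᶠ r in 𝓝[>] (0 : ℝ),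
      ∀ s ∈ Icc 0 c, |s - t| ≤ r → |u s - u t| ≤ M * r}) = 0 := by
    intro M
    refine le_antisymm ?_ zero_le
    refine (volume_image_le_of_frequently (I := Icc 0 c) (M : ℝ≥0) (fun t ht => ht.1.1)
      fun t ht => by simpa using ht.2).trans ?_
    rw [measure_mono_null (fun t ht => ht.1.2) hN, mul_zero]
  have hI : volume (u '' Icc 0 c) = 0 := by
    refine measure_mono_null ?_
      (measure_union_null h1 (measure_union_null h2 (measure_iUnion_null h3)))
    rintro _ ⟨t, ht, rfl⟩
    by_cases htN : t ∈ N
    · by_cases htE : t ∈ E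
      · exact Or.inr (Or.inl ⟨t, htE, rfl⟩)
      · obtain ⟨M, hM⟩ := hfin t ⟨ht, htE⟩
        exact Or.inr (Or.inr (mem_iUnion.2 ⟨M, t, ⟨⟨ht, htN⟩, hM⟩, rfl⟩))
    · exact Or.inl ⟨t, ⟨ht, htN⟩, rfl⟩
  have hsub : uIcc (u 0) (u c) ⊆ u '' Icc 0 c := by
    have := intermediate_value_uIcc (a := 0) (b := c) (f := u) (by rwa [uIcc_of_le hc])
    rwa [uIcc_of_le hc] at this
  have := measure_mono_null hsub hI
  rw [Real.volume_interval, ENNReal.ofReal_eq_zero] at this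
  have := abs_nonpos_iff.1 this
  linarith

theorem ae_finite_inter_preimage_of_hausdorffMeasure_lt_top {E : Type*} [MetricSpace E]
    [MeasurableSpace E] [BorelSpace E] {n : ℕ} {p : E → Fin n → ℝ} (hp : LipschitzWith 1 p)
    {G : Set E} (hG : μH[(n : ℝ)] G < ⊤) :
    ∀ᵐ y : Fin n → ℝ, (G ∩ p ⁻¹' {y}).Finite := by
  have hcov : ∀ k : ℕ, ∃ t : ℕ → Set E, G ⊆ ⋃ i, t i ∧
      (∀ i, Metric.ediam (t i) ≤ ((k : ℝ≥0∞) + 1)⁻¹) ∧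
      ∑' i, ⨆ _ : (t i).Nonempty, Metric.ediam (t i) ^ (n : ℝ) ≤ μH[(n : ℝ)] G + 1 := by
    intro k
    have hlt : μH[(n : ℝ)] G < μH[(n : ℝ)] G + 1 := ENNReal.lt_add_right hG.ne one_ne_zero
    have hle := Measure.hausdorffMeasure_apply (n : ℝ) G ▸ hlt
    have h1 := (le_iSup₂ (f := fun (r : ℝ≥0∞) (_ : 0 < r) =>
      ⨅ (t : ℕ → Set E) (_ : G ⊆ ⋃ n, t n) (_ : ∀ n, Metric.ediam (t n) ≤ r),
        ∑' i, ⨆ _ : (t i).Nonempty, Metric.ediam (t i) ^ (n : ℝ)) ((k : ℝ≥0∞) + 1)⁻¹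
        (by simp)).trans_lt hle
    simp only [iInf_lt_iff] at h1
    obtain ⟨t, ht1, ht2, ht3⟩ := h1
    refine ⟨t, ht1, ht2, ?_⟩
    rw [Measure.hausdorffMeasure_apply]
    exact ht3.le
  choose t htG htd hts using hcov
  let F : ℕ → (Fin n → ℝ) → ℝ≥0∞ := fun k y =>
    ∑' i, (toMeasurable volume (p '' t k i)).indicator (fun _ => (1 : ℝ≥0∞)) y
  have hFm : ∀ k, Measurable (F k) := fun k =>
    Measurable.tsum fun i => measurable_const.indicator (measurableSet_toMeasurable _ _)
  have hFi : ∀ k, ∫⁻ y, F k y ≤ μH[(n : ℝ)] G + 1 := by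
    intro k
    rw [lintegral_tsum fun i =>
      (measurable_const.indicator (measurableSet_toMeasurable _ _)).aemeasurable]
    refine le_trans (ENNReal.tsum_le_tsum fun i => ?_) (hts k)
    rw [lintegral_indicator_const (measurableSet_toMeasurable _ _), one_mul,
      measure_toMeasurable]
    rcases (t k i).eq_empty_or_nonempty with he | hne
    · simp [he]
    · simp only [hne, iSup_pos]
      refine (Real.volume_pi_le_diam_pow _).trans ?_
      rw [Fintype.card_fin, ENNReal.rpow_natCast]
      gcongr
      simpa using hp.ediam_image_le (t k i)
  have hlim : ∫⁻ y, liminf (fun k => F k y) atTop < ⊤ := by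
    refine (lintegral_liminf_le hFm).trans_lt ?_
    refine lt_of_le_of_lt ?_ (ENNReal.add_lt_top.2 ⟨hG, ENNReal.one_lt_top⟩)
    refine (liminf_le_liminf (Eventually.of_forall hFi)).trans ?_
    simp
  filter_upwards [ae_lt_top (Measurable.liminf hFm) hlim.ne] with y hy
  by_contra hinf
  obtain ⟨M, hM⟩ := ENNReal.exists_nat_gt hy.ne
  obtain ⟨S, hS, hScard⟩ := Set.Infinite.exists_subset_card_eq hinf M
  obtain ⟨k, hk1, hk2⟩ : ∃ k : ℕ, F k y < M ∧ ((k : ℝ≥0∞) + 1)⁻¹ < (S : Set E).einfsep := by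
    have hsep : 0 < (S : Set E).einfsep := S.finite_toSet.einfsep_pos
    have h1 : ∃ᶠ k in atTop, F k y < M := frequently_lt_of_liminf_lt (by isBoundedDefault) hM
    have h2 : ∀ᶠ k : ℕ in atTop, ((k : ℝ≥0∞) + 1)⁻¹ < (S : Set E).einfsep := by
      have := (ENNReal.tendsto_inv_nat_nhds_zero.comp
        (tendsto_add_atTop_nat 1)).eventually_lt_const hsep
      simpa using this
    exact (h1.and_eventually h2).exists
  have hmem : ∀ x : S, ∃ i, (x : E) ∈ t k i := fun x => mem_iUnion.1 (htG k (hS x.2).1)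
  choose i hi using hmem
  have hinj : Function.Injective i := by
    intro a b hab
    by_contra hne
    have hle := Metric.edist_le_ediam_of_mem (hi a) (hab ▸ hi b)
    have h3 := Set.einfsep_le_edist_of_mem (s := (S : Set E)) a.2 b.2 (fun h => hne (Subtype.ext h))
    exact absurd ((h3.trans hle).trans (htd k _)) (not_le.2 hk2)
  refine absurd hk1 (not_lt.2 ?_)
  calc (M : ℝ≥0∞) = ∑ x : S, 1 := by simp [hScard]
    _ = ∑ x : S, (toMeasurable volume (p '' t k (i x))).indicator (fun _ => (1 : ℝ≥0∞)) y := by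
        refine Finset.sum_congr rfl fun x _ => ?_
        rw [indicator_of_mem]
        exact subset_toMeasurable _ _ ⟨x, hi x, (hS x.2).2⟩
    _ = ∑ j ∈ Finset.univ.map ⟨i, hinj⟩,
          (toMeasurable volume (p '' t k j)).indicator (fun _ => (1 : ℝ≥0∞)) y := by
        rw [Finset.sum_map]; rfl
    _ ≤ F k y := ENNReal.sum_le_tsum _

theorem isOpenMap_comp_of_isClosedEmbedding {X K : Type*} [TopologicalSpace X] [NormalSpace X]
    [TopologicalSpace K] [CompactSpace K] (κ : C(K, X)) (hκ : IsClosedEmbedding κ) :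
    IsOpenMap fun f : C(X, ℝ) => f.comp κ := by
  have hext : ∀ h : C(K, ℝ), ∃ g : BoundedContinuousFunction X ℝ,
      ‖g‖ = ‖h‖ ∧ ∀ x, g (κ x) = h x := by
    intro h
    obtain ⟨g, hg1, hg2⟩ := BoundedContinuousFunction.exists_extension_norm_eq_of_isClosedEmbedding
      (BoundedContinuousFunction.mkOfCompact h) hκ
    exact ⟨g, by rw [hg1, BoundedContinuousFunction.norm_mkOfCompact], fun x => congrFun hg2 x⟩
  choose ext hnorm hextend using hext
  refine IsOpenMap.of_sections fun f => ⟨fun h => f + (ext (h - f.comp κ)).toContinuousMap,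
    ?_, ?_, ?_⟩
  · have h0 : Tendsto (fun h : C(K, ℝ) => ext (h - f.comp κ)) (𝓝 (f.comp κ)) (𝓝 0) := by
      rw [tendsto_zero_iff_norm_tendsto_zero]
      simp only [hnorm]
      have : Continuous fun h : C(K, ℝ) => ‖h - f.comp κ‖ := by fun_prop
      simpa using this.tendsto (f.comp κ)
    have hz : ext (f.comp κ - f.comp κ) = 0 := by
      rw [← norm_eq_zero, hnorm, sub_self, norm_zero]
    refine tendsto_const_nhds.add ?_
    rw [hz, ContinuousMap.tendsto_iff_forall_isCompact_tendstoUniformlyOn]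
    intro L _
    exact (BoundedContinuousFunction.tendsto_iff_tendstoUniformly.1 h0).tendstoUniformlyOn
  · have hz : ext (f.comp κ - f.comp κ) = 0 := by
      rw [← norm_eq_zero, hnorm, sub_self, norm_zero]
    ext x
    change f x + ext (f.comp κ - f.comp κ) x = f x
    rw [hz]
    exact add_zero (f x)
  · intro h
    ext x
    simp [hextend]

theorem floor_eq_of_abs_sub_le {m θ : ℝ} (hm : 0 < m) {s t : ℝ}
    (ht : ∀ k : ℤ, θ < |m * t - k|) (hst : m * |s - t| ≤ θ) : ⌊m * s⌋ = ⌊m * t⌋ := by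
  have h1 : |m * s - m * t| ≤ θ := by
    rwa [← mul_sub, abs_mul, abs_of_pos hm]
  have h2 := abs_le.1 h1
  rcases lt_trichotomy ⌊m * s⌋ ⌊m * t⌋ with h | h | h
  · exfalso
    have h3 := Int.floor_lt.1 h
    have h4 := Int.floor_le (m * t)
    have h5 := ht ⌊m * t⌋
    rw [abs_of_nonneg (by linarith)] at h5
    linarith
  · exact h
  · exfalso
    have h3 := Int.floor_lt.1 h
    have h4 := Int.floor_le (m * s)
    have h5 := ht ⌊m * s⌋
    rw [abs_of_nonpos (by linarith)] at h5
    linarith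

/-- Functions with small oscillation on all fibre segments of one common small radius, centred
outside a set of small measure. -/
def flatFunctions (Y : Type*) [TopologicalSpace Y] (c : ℝ) (k : ℕ) : Set C(Y × Icc (0 : ℝ) c, ℝ) :=
  {h | ∃ (δ a : ℝ) (J : Set ℝ), 0 < δ ∧ δ < ((k : ℝ) + 1)⁻¹ ∧ a < δ / (k + 1) ∧
    volume (Icc 0 c \ J) ≤ (2⁻¹ : ℝ≥0∞) ^ k ∧
    ∀ (y : Y) (s t : Icc (0 : ℝ) c), (t : ℝ) ∈ J → |(s : ℝ) - t| ≤ δ → |h (y, s) - h (y, t)| ≤ a}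

theorem isOpen_flatFunctions (Y : Type*) [TopologicalSpace Y] [CompactSpace Y] (c : ℝ) (k : ℕ) :
    IsOpen (flatFunctions Y c k) := by
  rw [Metric.isOpen_iff]
  rintro h ⟨δ, a, J, hδ, hδk, ha, hJ, hh⟩
  refine ⟨(δ / (k + 1) - a) / 3, by linarith, fun g hg => ?_⟩
  refine ⟨δ, a + 2 * ((δ / (k + 1) - a) / 3), J, hδ, hδk, by linarith, hJ, fun y s t ht hst => ?_⟩
  have h1 := hh y s t ht hst
  have h2 := (ContinuousMap.dist_apply_le_dist (f := g) (g := h) (y, s)).trans_lt hg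
  have h3 := (ContinuousMap.dist_apply_le_dist (f := g) (g := h) (y, t)).trans_lt hg
  rw [Real.dist_eq, abs_lt] at h2 h3
  rw [abs_le] at h1 ⊢
  constructor <;> linarith

theorem exists_pos_volume_near_grid_le (c : ℝ) {m : ℝ} (hm : 0 < m) {ε : ℝ≥0∞} (hε : 0 < ε)
    {b : ℝ} (hb : 0 < b) : ∃ θ : ℝ, 0 < θ ∧ θ < b ∧
      volume (Icc 0 c \ {t : ℝ | ∀ k : ℤ, 2 * θ < |m * t - k|}) ≤ ε := by
  let P : ℕ := ⌈m * c⌉₊ + 1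
  have hsub : ∀ θ : ℝ, θ < 1 / 2 → Icc 0 c \ {t : ℝ | ∀ k : ℤ, 2 * θ < |m * t - k|} ⊆
      ⋃ k ∈ Finset.range (P + 1), Metric.closedBall ((k : ℝ) / m) (2 * θ / m) := by
    rintro θ hθ t ⟨ht, hnot⟩
    simp only [mem_ofPred_eq, not_forall, not_lt] at hnot
    obtain ⟨k, hk⟩ := hnot
    have hk' := abs_le.1 hk
    have h0 : 0 ≤ m * t := mul_nonneg hm.le ht.1
    have h1 : m * t ≤ m * c := by gcongr; exact ht.2
    have hk0 : 0 ≤ k := by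
      have : (-1 : ℝ) < k := by linarith
      have : (-1 : ℤ) < k := by exact_mod_cast this
      omega
    lift k to ℕ using hk0
    have hkP : k < P + 1 := by
      have h2 : (k : ℝ) < (P : ℝ) + 1 := by
        have := Nat.le_ceil (m * c)
        simp only [P]
        push_cast at hk' ⊢
        linarith
      exact_mod_cast h2
    refine mem_iUnion₂.2 ⟨k, Finset.mem_range.2 hkP, ?_⟩
    rw [Metric.mem_closedBall, Real.dist_eq, le_div_iff₀ hm]
    calc |t - k / m| * m = |(t - k / m) * m| := by rw [abs_mul, abs_of_pos hm]
      _ = |m * t - k| := by congr 1; field_simp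
      _ ≤ 2 * θ := by simpa using hk
  have hvol : ∀ θ : ℝ, θ < 1 / 2 →
      volume (Icc 0 c \ {t : ℝ | ∀ k : ℤ, 2 * θ < |m * t - k|}) ≤
        (P + 1 : ℕ) * ENNReal.ofReal (2 * (2 * θ / m)) := by
    intro θ hθ
    refine (measure_mono (hsub θ hθ)).trans ((measure_biUnion_finset_le _ _).trans ?_)
    simp [Real.volume_closedBall]
  have hlim : Tendsto (fun θ : ℝ => ((P + 1 : ℕ) : ℝ≥0∞) * ENNReal.ofReal (2 * (2 * θ / m)))
      (𝓝[>] 0) (𝓝 (((P + 1 : ℕ) : ℝ≥0∞) * ENNReal.ofReal (2 * (2 * 0 / m)))) := by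
    refine Tendsto.mono_left ?_ nhdsWithin_le_nhds
    refine ENNReal.Tendsto.const_mul ?_ (Or.inr (ENNReal.natCast_ne_top _))
    refine ENNReal.tendsto_ofReal ?_
    exact Continuous.tendsto (f := fun θ : ℝ => 2 * (2 * θ / m)) (by fun_prop) 0
  simp only [mul_zero, zero_div, ENNReal.ofReal_zero] at hlim
  obtain ⟨θ, ⟨hθ1, hθ2⟩, hθ3⟩ := ((hlim.eventually_lt_const hε).and
    (Ioo_mem_nhdsGT (show (0 : ℝ) < min b (1 / 2) by positivity))).exists.imp
      fun θ h => (⟨h.2, h.1⟩ : θ ∈ Ioo 0 (min b (1 / 2)) ∧ _)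
  exact ⟨θ, hθ1, hθ2.trans_le (min_le_left _ _),
    (hvol θ (hθ2.trans_le (min_le_right _ _))).trans hθ3.le⟩

theorem dense_flatFunctions (Y : Type*) [MetricSpace Y] [CompactSpace Y] (c : ℝ) (k : ℕ) :
    Dense (flatFunctions Y c k) := by
  rw [Metric.dense_iff]
  intro h ε hε
  obtain ⟨η, hη, hunif⟩ := Metric.uniformContinuous_iff.1
    (CompactSpace.uniformContinuous_of_continuous h.continuous) (ε / 2) (half_pos hε)
  obtain ⟨m, hm⟩ := exists_nat_gt η⁻¹
  have hm0 : (0 : ℝ) < m := (inv_pos.2 hη).trans hm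
  have hmη : 1 / (m : ℝ) < η := by
    rw [one_div]; exact inv_lt_of_inv_lt₀ hη hm
  obtain ⟨θ, hθ, hθb, hvol⟩ := exists_pos_volume_near_grid_le c hm0
    (ε := (2⁻¹ : ℝ≥0∞) ^ k) (ENNReal.pow_pos (by simp) _)
    (b := m * ((k : ℝ) + 1)⁻¹) (by positivity)
  have hfl : ∀ t : Icc (0 : ℝ) c, (⌊m * (t : ℝ)⌋ : ℝ) / m ∈ Icc (0 : ℝ) c ∧
      |(⌊m * (t : ℝ)⌋ : ℝ) / m - t| ≤ 1 / m := by
    intro t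
    have h0 : 0 ≤ (m : ℝ) * t := mul_nonneg hm0.le t.2.1
    have h1 : (⌊m * (t : ℝ)⌋ : ℝ) / m ≤ t := by
      rw [div_le_iff₀ hm0, mul_comm]; exact Int.floor_le _
    have h2 : (t : ℝ) ≤ (⌊m * (t : ℝ)⌋ : ℝ) / m + 1 / m := by
      rw [← add_div, le_div_iff₀ hm0, mul_comm]; exact (Int.lt_floor_add_one _).le
    refine ⟨⟨div_nonneg (by exact_mod_cast Int.floor_nonneg.2 h0) hm0.le, h1.trans t.2.2⟩, ?_⟩
    rw [abs_le]
    constructor <;> linarith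
  let q : Icc (0 : ℝ) c → Icc (0 : ℝ) c := fun t => ⟨_, (hfl t).1⟩
  have hq : ∀ s t : Icc (0 : ℝ) c, ⌊m * (s : ℝ)⌋ = ⌊m * (t : ℝ)⌋ → q s = q t := by
    intro s t hst
    simp only [q, hst]
  let D : Set (Y × Icc (0 : ℝ) c) := {z | ∀ j : ℤ, θ ≤ |m * (z.2 : ℝ) - j|}
  have hD : IsClosed D := by
    simp only [D, ofPred_forall]
    exact isClosed_iInter fun j => isClosed_le (by fun_prop) (by fun_prop)
  have hqD : Continuous fun z : D => q z.1.2 := by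
    refine IsLocallyConstant.continuous ((IsLocallyConstant.iff_eventually_eq _).2 fun z => ?_)
    have hc : Continuous fun w : D => (m : ℝ) * |(w.1.2 : ℝ) - z.1.2| := by fun_prop
    have hlt : (m : ℝ) * |(z.1.2 : ℝ) - z.1.2| < θ / 2 := by simpa using hθ
    filter_upwards [hc.continuousAt.eventually_lt_const hlt] with w hw
    exact hq _ _ (floor_eq_of_abs_sub_le hm0
      (fun j => (half_lt_self hθ).trans_le (z.2 j)) hw.le)
  have hDc : CompactSpace D := isCompact_iff_compactSpace.1 hD.isCompact
  let e : C(D, ℝ) := ⟨fun z => h (z.1.1, q z.1.2) - h z.1,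
    (h.continuous.comp ((continuous_fst.comp continuous_subtype_val).prodMk hqD)).sub
      (h.continuous.comp continuous_subtype_val)⟩
  have he : ‖BoundedContinuousFunction.mkOfCompact e‖ ≤ ε / 2 := by
    rw [BoundedContinuousFunction.norm_le (half_pos hε).le]
    intro z
    have : dist (z.1.1, q z.1.2) z.1 < η := by
      rw [Prod.dist_eq, dist_self, max_eq_right dist_nonneg, Subtype.dist_eq, Real.dist_eq]
      exact (hfl z.1.2).2.trans_lt hmη
    exact (hunif this).le
  obtain ⟨g, hg1, hg2⟩ := BoundedContinuousFunction.exists_norm_eq_domRestrict_eq_of_closed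
    (BoundedContinuousFunction.mkOfCompact e) hD
  have hgD : ∀ y t, (y, t) ∈ D → (h + g.toContinuousMap) (y, t) = h (y, q t) := by
    intro y t hyt
    have h1 : g (y, t) = h (y, q t) - h (y, t) := DFunLike.congr_fun hg2 ⟨(y, t), hyt⟩
    change h (y, t) + g (y, t) = _
    rw [h1]
    ring
  refine ⟨h + g.toContinuousMap, ?_, θ / m, 0, _, by positivity, ?_, by positivity, hvol, ?_⟩
  · rw [Metric.mem_ball, ContinuousMap.dist_lt_iff hε]
    intro z
    have h1 : |g z| ≤ ε / 2 := ((g.norm_coe_le_norm z).trans hg1.le).trans he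
    change dist (h z + g z) (h z) < ε
    rw [Real.dist_eq, add_sub_cancel_left]
    linarith
  · rwa [div_lt_iff₀ hm0, mul_comm]
  · intro y s t ht hst
    rw [le_div_iff₀ hm0, mul_comm] at hst
    have hs : ∀ j : ℤ, θ ≤ |m * (s : ℝ) - j| := by
      intro j
      have h1 := abs_sub_abs_le_abs_sub (m * (t : ℝ) - j) (m * (s : ℝ) - j)
      have h2 : |m * (t : ℝ) - j - (m * (s : ℝ) - j)| = m * |(s : ℝ) - t| := by
        rw [abs_sub_comm (s : ℝ), ← abs_of_pos hm0, ← abs_mul, abs_of_pos hm0]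
        congr 1
        ring
      have h3 : 2 * θ < |m * (t : ℝ) - j| := ht j
      linarith
    rw [hgD y s hs, hgD y t fun j => (by linarith [ht j] : θ ≤ |m * (t : ℝ) - j|),
      hq s t (floor_eq_of_abs_sub_le hm0 (fun j => by linarith [ht j]) hst), sub_self, abs_zero]

theorem exists_nat_frequently_of_lipGauge_ne_top {X : Type*} [PseudoMetricSpace X] {f : X → ℝ}
    {x : X} (h : lipGauge (fun r => r) f x ≠ ⊤) :
    ∃ M : ℕ, ∃ᶠ r in 𝓝[>] (0 : ℝ), ∀ z, dist z x ≤ r → |f z - f x| ≤ M * r := by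
  obtain ⟨M, hM⟩ := ENNReal.exists_nat_gt h
  refine ⟨M, ((frequently_lt_of_liminf_lt (by isBoundedDefault) hM).and_eventually
    self_mem_nhdsWithin).mono ?_⟩
  rintro r ⟨hr, hr0 : 0 < r⟩ z hz
  have h1 : edist (f z) (f x) ≤ Metric.ediam (f '' Metric.closedBall x r) :=
    Metric.edist_le_ediam_of_mem (mem_image_of_mem f hz)
      (mem_image_of_mem f (Metric.mem_closedBall_self hr0.le))
  have h2 : Metric.ediam (f '' Metric.closedBall x r) ≤ M * ENNReal.ofReal r :=
    (ENNReal.div_le_iff (by simpa using hr0) ENNReal.ofReal_ne_top).1 hr.le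
  have h3 := h1.trans h2
  rw [edist_dist, ← ENNReal.ofReal_natCast, ← ENNReal.ofReal_mul (by positivity),
    ENNReal.ofReal_le_ofReal_iff (by positivity), Real.dist_eq] at h3
  exact h3

theorem exists_null_frequently_of_mem_flatFunctions {Y : Type*} [TopologicalSpace Y] {c : ℝ}
    {h : C(Y × Icc (0 : ℝ) c, ℝ)} (hh : ∀ k, h ∈ flatFunctions Y c k) :
    ∃ N : Set ℝ, volume N = 0 ∧ ∀ t : Icc (0 : ℝ) c, (t : ℝ) ∉ N → ∀ M : ℝ≥0, 0 < M →
      ∀ y, ∃ᶠ r in 𝓝[>] (0 : ℝ), ∀ s : Icc (0 : ℝ) c, |(s : ℝ) - t| ≤ r →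
        |h (y, s) - h (y, t)| ≤ M * r := by
  choose δ a J hδ hδk ha hJ hflat using hh
  have hsum : ∑' k, volume (Icc 0 c \ J k) ≠ ⊤ := by
    refine ne_top_of_le_ne_top ?_ (ENNReal.tsum_le_tsum hJ)
    rw [ENNReal.tsum_geometric, ENNReal.one_sub_inv_two, inv_inv]
    simp
  refine ⟨_, ae_eventually_notMem hsum, fun t ht M hM y => ?_⟩
  have ht' : ∀ᶠ k in atTop, (t : ℝ) ∉ Icc 0 c \ J k := not_not.1 ht
  have hinv : Tendsto (fun k : ℕ => ((k : ℝ) + 1)⁻¹) atTop (𝓝 0) := by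
    simpa using tendsto_one_div_add_atTop_nhds_zero_nat (𝕜 := ℝ)
  have hδ0 : Tendsto δ atTop (𝓝[>] 0) :=
    tendsto_nhdsWithin_iff.2 ⟨squeeze_zero (fun k => (hδ k).le) (fun k => (hδk k).le) hinv,
      Eventually.of_forall hδ⟩
  refine hδ0.frequently (Eventually.frequently ?_)
  filter_upwards [ht', hinv.eventually_lt_const (show (0 : ℝ) < M from hM)] with k hk hkM s hs
  have htJ : (t : ℝ) ∈ J k := by
    by_contra hn
    exact hk ⟨t.2, hn⟩
  refine (hflat k y s t htJ hs).trans ((ha k).le.trans ?_)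
  rw [div_eq_inv_mul]
  exact mul_le_mul_of_nonneg_right hkM.le (hδ k).le

theorem not_exists_iUnion_hausdorffMeasure_lt_top {E : Type*} [MetricSpace E] [MeasurableSpace E]
    [BorelSpace E] {n : ℕ} {c : ℝ} (hc : 0 < c) {Ω : Set E}
    {κ : C(Metric.closedBall (0 : Fin n → ℝ) c × Icc (0 : ℝ) c, Ω)}
    (hdist : ∀ y s t, dist (κ (y, s)) (κ (y, t)) ≤ |(s : ℝ) - t|) (hinj : Function.Injective κ)
    {p : E → Fin n → ℝ} (hp : LipschitzWith 1 p) (hpκ : ∀ z, p (κ z) = z.1) {f : C(Ω, ℝ)}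
    (hflat : ∀ k, f.comp κ ∈ flatFunctions _ c k)
    {y₀ : Metric.closedBall (0 : Fin n → ℝ) c} (hy₀ : (y₀ : Fin n → ℝ) = 0)
    (hne : f (κ (y₀, ⟨0, left_mem_Icc.2 hc.le⟩)) ≠ f (κ (y₀, ⟨c, right_mem_Icc.2 hc.le⟩))) :
    ¬ ∃ G : ℕ → Set E,
      ({x : E | ∃ hx : x ∈ Ω, lipGauge (fun r => r) (⇑f) ⟨x, hx⟩ = ⊤} ⊆ ⋃ n, G n) ∧
      ∀ i, μH[(n : ℝ)] (G i) < ⊤ := by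
  rintro ⟨G, hGcov, hG⟩
  obtain ⟨N, hN, hNflat⟩ := exists_null_frequently_of_mem_flatFunctions hflat
  have hae : ∀ᵐ y : Fin n → ℝ, ∀ i, (G i ∩ p ⁻¹' {y}).Finite :=
    ae_all_iff.2 fun i => ae_finite_inter_preimage_of_hausdorffMeasure_lt_top hp (hG i)
  have hline : ∀ y : Metric.closedBall (0 : Fin n → ℝ) c,
      (∀ i, (G i ∩ p ⁻¹' {(y : Fin n → ℝ)}).Finite) →
      f (κ (y, ⟨0, left_mem_Icc.2 hc.le⟩)) = f (κ (y, ⟨c, right_mem_Icc.2 hc.le⟩)) := by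
    intro y hy
    let u : ℝ → ℝ := IccExtend hc.le fun t => f (κ (y, t))
    have hu : ∀ t : Icc (0 : ℝ) c, u t = f (κ (y, t)) := fun t => IccExtend_val hc.le _ t
    have hcount : (⋃ i, G i ∩ p ⁻¹' {(y : Fin n → ℝ)}).Countable :=
      countable_iUnion fun i => (hy i).countable
    let T : Set (Icc (0 : ℝ) c) :=
      (fun t => ((κ (y, t) : Ω) : E)) ⁻¹' ⋃ i, G i ∩ p ⁻¹' {(y : Fin n → ℝ)}
    have hT : T.Countable := by
      refine hcount.preimage_of_injOn (Function.Injective.injOn fun s t hst => ?_)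
      exact (Prod.ext_iff.1 (hinj (Subtype.ext hst))).2
    have key := eq_endpoints_of_frequently (u := u) (c := c) hc.le
      (Continuous.continuousOn (by
        refine Continuous.Icc_extend' ?_
        fun_prop)) (N := N) hN (hT.image Subtype.val) ?_ ?_
    · rwa [show (0 : ℝ) = ((⟨0, left_mem_Icc.2 hc.le⟩ : Icc (0 : ℝ) c) : ℝ) from rfl, hu,
        show u c = u ((⟨c, right_mem_Icc.2 hc.le⟩ : Icc (0 : ℝ) c) : ℝ) from rfl, hu] at key
    · rintro t ⟨ht, htT⟩
      have hfin : lipGauge (fun r => r) (⇑f) (κ (y, ⟨t, ht⟩)) ≠ ⊤ := by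
        intro htop
        refine htT ⟨⟨t, ht⟩, ?_, rfl⟩
        obtain ⟨i, hi⟩ := mem_iUnion.1 (hGcov ⟨(κ (y, ⟨t, ht⟩)).2, htop⟩)
        exact mem_iUnion.2 ⟨i, hi, hpκ _⟩
      obtain ⟨M, hM⟩ := exists_nat_frequently_of_lipGauge_ne_top hfin
      refine ⟨M, hM.mono fun r hr s hs hst => ?_⟩
      have := hr (κ (y, ⟨s, hs⟩)) ((hdist _ _ _).trans hst)
      rwa [← hu, ← hu] at this
    · rintro t ⟨ht, htN⟩ M hM
      refine (hNflat ⟨t, ht⟩ htN M hM y).mono fun r hr s hs hst => ?_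
      have := hr ⟨s, hs⟩ hst
      simp only [ContinuousMap.comp_apply] at this
      rwa [← hu, ← hu] at this
  have hcont : ContinuousAt (fun y : Metric.closedBall (0 : Fin n → ℝ) c =>
      f (κ (y, ⟨0, left_mem_Icc.2 hc.le⟩)) - f (κ (y, ⟨c, right_mem_Icc.2 hc.le⟩))) y₀ := by
    fun_prop
  have hev := hcont.eventually_ne (sub_ne_zero.2 hne)
  rw [nhds_subtype_eq_comap, eventually_comap, hy₀] at hev
  have hdense := Measure.dense_of_ae hae
  obtain ⟨y, hy, hyG⟩ := (mem_closure_iff_nhds.1 (hdense 0)) _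
    (inter_mem hev (Metric.closedBall_mem_nhds (0 : Fin n → ℝ) hc))
  exact hy.1 ⟨y, hy.2⟩ rfl (sub_eq_zero.2 (hline ⟨y, hy.2⟩ hyG))

theorem exists_segment_chart {n : ℕ} {Ω : Set (EuclideanSpace ℝ (Fin (n + 1)))}
    (hint : (interior Ω).Nonempty) :
    ∃ c : ℝ, 0 < c ∧ ∃ κ : C(Metric.closedBall (0 : Fin n → ℝ) c × Icc (0 : ℝ) c, Ω),
      (∀ y s t, dist (κ (y, s)) (κ (y, t)) ≤ |(s : ℝ) - t|) ∧ Function.Injective κ ∧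
      ∃ p : EuclideanSpace ℝ (Fin (n + 1)) → Fin n → ℝ,
        LipschitzWith 1 p ∧ ∀ z, p (κ z) = z.1 := by
  obtain ⟨x, hx⟩ := hint
  let φ : (Fin n → ℝ) × ℝ → EuclideanSpace ℝ (Fin (n + 1)) := fun z =>
    WithLp.toLp 2 (Fin.cons (x 0 + z.2) fun i => x i.succ + z.1 i)
  have hφ : Continuous φ := by
    refine (PiLp.continuous_toLp 2 _).comp (continuous_pi fun i => ?_)
    refine Fin.cases ?_ (fun j => ?_) i
    · simp only [Fin.cons_zero]; fun_prop
    · simp only [Fin.cons_succ]; fun_prop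
  have hφ0 : φ 0 = x := by
    ext i
    refine Fin.cases ?_ (fun j => ?_) i <;> simp [φ]
  have hnhds : φ ⁻¹' interior Ω ∈ 𝓝 (0 : (Fin n → ℝ) × ℝ) :=
    hφ.continuousAt.preimage_mem_nhds (hφ0 ▸ isOpen_interior.mem_nhds hx)
  obtain ⟨c, hc, hcφ⟩ := Metric.nhds_basis_closedBall.mem_iff.1 hnhds
  have hmem : ∀ z : Metric.closedBall (0 : Fin n → ℝ) c × Icc (0 : ℝ) c,
      φ (z.1, z.2) ∈ Ω := by
    intro z
    refine interior_subset (hcφ ?_)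
    rw [Metric.mem_closedBall, Prod.dist_eq, max_le_iff]
    refine ⟨z.1.2, ?_⟩
    change dist (z.2 : ℝ) 0 ≤ c
    rw [Real.dist_eq, sub_zero, abs_of_nonneg z.2.2.1]
    exact z.2.2.2
  let p : EuclideanSpace ℝ (Fin (n + 1)) → Fin n → ℝ := fun w i => w i.succ - x i.succ
  have hpφ : ∀ z, p (φ z) = z.1 := fun z => by ext i; simp [p, φ]
  refine ⟨c, hc, ⟨fun z => ⟨φ (z.1, z.2), hmem z⟩, by fun_prop⟩, fun y s t => ?_, ?_, p, ?_,
    fun z => hpφ _⟩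
  · change dist (φ (y, s)) (φ (y, t)) ≤ _
    rw [EuclideanSpace.dist_eq, Fin.sum_univ_succ]
    simp [φ, Real.dist_eq, Real.sqrt_sq_eq_abs]
  · intro z w hzw
    have h1 : φ (z.1, z.2) = φ (w.1, w.2) := congrArg Subtype.val hzw
    have h2 : (z.1 : Fin n → ℝ) = w.1 := by
      simpa only [hpφ] using congrArg p h1
    have h3 : (z.2 : ℝ) = w.2 := by
      simpa [φ] using congrArg (fun v : EuclideanSpace ℝ (Fin (n + 1)) => v 0) h1
    exact Prod.ext (Subtype.ext h2) (Subtype.ext h3)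
  · refine LipschitzWith.of_dist_le_mul fun v w => ?_
    rw [NNReal.coe_one, one_mul, dist_pi_le_iff dist_nonneg]
    intro i
    simp only [p, dist_sub_right]
    rw [dist_eq_norm, dist_eq_norm]
    exact PiLp.norm_apply_le (v - w) i.succ

theorem dense_setOf_apply_ne {K : Type*} [TopologicalSpace K] [CompactSpace K] [T2Space K]
    {a b : K} (hab : a ≠ b) : Dense {h : C(K, ℝ) | h a ≠ h b} := by
  obtain ⟨g, hga, hgb, -⟩ := exists_continuous_zero_one_of_isClosed
    (isClosed_singleton (x := a)) (isClosed_singleton (x := b)) (by simpa using hab)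
  intro h
  by_cases hh : h a = h b
  · have ht : Tendsto (fun ε : ℝ => h + ε • g) (𝓝[≠] 0) (𝓝 h) := by
      refine Tendsto.mono_left ?_ nhdsWithin_le_nhds
      have : Continuous fun ε : ℝ => h + ε • g := by fun_prop
      simpa using this.tendsto 0
    refine mem_closure_of_tendsto ht (eventually_nhdsWithin_of_forall fun ε hε => ?_)
    have ha : g a = 0 := hga rfl
    have hb : g b = 1 := hgb rfl
    simpa [ha, hb, hh] using (hε : ε ≠ 0)
  · exact subset_closure hh

theorem stmt1
    (d : ℕ) (hd : 0 < d) (Ω : Set (EuclideanSpace ℝ (Fin d)))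
    (hΩ : LocallyCompactSpace Ω) (hint : (interior Ω).Nonempty) :
    ∀ᶠ f : C(↥Ω, ℝ) in residual C(↥Ω, ℝ),
      ¬ ∃ G : ℕ → Set (EuclideanSpace ℝ (Fin d)),
          ({x : EuclideanSpace ℝ (Fin d) |
              ∃ hx : x ∈ Ω, lipGauge (fun r => r) (⇑f) ⟨x, hx⟩ = ⊤} ⊆ ⋃ n, G n) ∧
          ∀ n, μH[(d : ℝ) - 1] (G n) < ⊤ := by
  obtain ⟨n, rfl⟩ : ∃ n, d = n + 1 := ⟨d - 1, by omega⟩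
  obtain ⟨c, hc, κ, hdist, hinj, p, hp, hpκ⟩ := exists_segment_chart hint
  have hopen := isOpenMap_comp_of_isClosedEmbedding κ (κ.continuous.isClosedEmbedding hinj)
  have hcont : Continuous fun f : C(Ω, ℝ) => f.comp κ := ContinuousMap.continuous_precomp κ
  let y₀ : Metric.closedBall (0 : Fin n → ℝ) c := ⟨0, Metric.mem_closedBall_self hc.le⟩
  have hab : (y₀, (⟨0, left_mem_Icc.2 hc.le⟩ : Icc (0 : ℝ) c)) ≠
      (y₀, ⟨c, right_mem_Icc.2 hc.le⟩) := fun h =>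
    hc.ne (congrArg (fun z : _ × Icc (0 : ℝ) c => (z.2 : ℝ)) h)
  have hne := residual_of_dense_open
    ((isOpen_ne_fun (continuous_eval_const _)
      (continuous_eval_const _)).preimage hcont)
    ((dense_setOf_apply_ne hab).preimage hopen)
  have hflat : ∀ᶠ f : C(Ω, ℝ) in residual C(Ω, ℝ), ∀ k, f.comp κ ∈ flatFunctions _ c k :=
    eventually_countable_forall.2 fun k => residual_of_dense_open
      ((isOpen_flatFunctions _ c k).preimage hcont) ((dense_flatFunctions _ c k).preimage hopen)
  filter_upwards [hne, hflat] with f hf1 hf2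
  have := not_exists_iUnion_hausdorffMeasure_lt_top hc hdist hinj hp hpκ hf2 (y₀ := y₀) rfl hf1
  rwa [show ((n + 1 : ℕ) : ℝ) - 1 = n by push_cast; ring]
end

section
/- Let d be a positive integer, let Ω ⊆ ℝ^d be a locally compact set, and let φ be any gauge. Then for a typical function f ∈ C(Ω), the lower packing dimension of the set {x ∈ Ω : lip_φ f(x) > 0} is at most d−1. -/
open Filter Set Topology MeasureTheory
open scoped ENNReal NNReal

lemma EuclideanSpace.dist_le_card_mul {n : ℕ} {c : ℝ} (hc : 0 ≤ c)
    {x y : EuclideanSpace ℝ (Fin n)} (h : ∀ i, |x i - y i| ≤ c) : dist x y ≤ n * c := by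
  rw [EuclideanSpace.dist_eq]
  apply Real.sqrt_le_iff.2 ⟨by positivity, ?_⟩
  calc ∑ i, dist (x i) (y i) ^ 2 ≤ ∑ _i : Fin n, c ^ 2 := by
        refine Finset.sum_le_sum fun i _ => ?_
        rw [Real.dist_eq]
        exact pow_le_pow_left₀ (abs_nonneg _) (h i) 2
    _ = n * c ^ 2 := by simp
    _ ≤ (n * c) ^ 2 := by
        rw [mul_pow]
        refine mul_le_mul_of_nonneg_right ?_ (sq_nonneg c)
        exact_mod_cast Nat.le_self_pow two_ne_zero n

lemma coverNum_le_card {X ι : Type*} [PseudoMetricSpace X] [Fintype ι] {δ : ℝ} {E : Set X}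
    (F : ι → Set X) (hF : ∀ i, Metric.ediam (F i) ≤ ENNReal.ofReal δ) (hE : E ⊆ ⋃ i, F i) :
    coverNum δ E ≤ (Fintype.card ι : ℝ≥0∞) := by
  refine iInf₂_le (Fintype.card ι) ⟨fun j => F ((Fintype.equivFin ι).symm j), fun j => hF _, ?_⟩
  rwa [(Fintype.equivFin ι).symm.surjective.iUnion_comp]

lemma coverNum_mono {X : Type*} [PseudoMetricSpace X] {δ : ℝ} {E E' : Set X} (h : E ⊆ E') :
    coverNum δ E ≤ coverNum δ E' :=
  iInf_mono fun _ => iInf_mono' fun ⟨F, hF, hE⟩ => ⟨⟨F, hF, h.trans hE⟩, le_rfl⟩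

/-- The points of the ball of radius `R` having a coordinate within `2 * s` of `δ * ℤ`. -/
def gridSlab (n : ℕ) (δ R s : ℝ) : Set (EuclideanSpace ℝ (Fin n)) :=
  {x | ‖x‖ ≤ R ∧ ∃ i, ∃ k : ℤ, |x i - k * δ| ≤ 2 * s}

lemma coverNum_gridSlab_le (m : ℕ) {δ R : ℝ} (hδ : 0 < δ) (hR : 0 < R) :
    ∃ C : ℝ, 0 < C ∧ ∀ s : ℝ, 0 < s → s ≤ 1 →
      coverNum s (gridSlab (m + 1) δ R s) ≤ ENNReal.ofReal (C * (s⁻¹) ^ m) := by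
  set D : ℝ := (m : ℝ) + 1 with hD
  have hD0 : 0 < D := by positivity
  set M : ℤ := ⌈(R + 2) / δ⌉ with hM
  have hM0 : 0 ≤ M := Int.ceil_nonneg (by positivity)
  set N : ℤ := 2 * ((m : ℤ) + 1) + 1 with hN
  refine ⟨(m + 1) * ((2 * M + 1) * (2 * N + 1)) * (2 * R * D + 5) ^ m, ?_, ?_⟩
  · have : (0 : ℝ) ≤ M := by exact_mod_cast hM0
    have : (0 : ℝ) ≤ N := by rw [hN]; positivity
    positivity
  intro s hs hs1
  set L : ℤ := ⌈R * D / s⌉ + 1 with hL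
  have hL0 : 0 ≤ L := by
    have : 0 ≤ ⌈R * D / s⌉ := Int.ceil_nonneg (by positivity)
    omega
  let ι := Fin (m + 1) × (Finset.Icc (-M) M × Finset.Icc (-N) N) × (Fin m → Finset.Icc (-L) L)
  let F : ι → Set (EuclideanSpace ℝ (Fin (m + 1))) := fun p =>
    {x | ⌊x p.1 * D / s⌋ = ⌊((p.2.1.1 : ℤ) : ℝ) * δ * D / s⌋ + (p.2.1.2 : ℤ) ∧
      ∀ j, ⌊x (p.1.succAbove j) * D / s⌋ = (p.2.2 j : ℤ)}
  have hcell : ∀ u v : ℝ, ⌊u * D / s⌋ = ⌊v * D / s⌋ → |u - v| ≤ s / D := by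
    intro u v h
    have h1 := (Int.abs_sub_lt_one_of_floor_eq_floor h).le
    rw [← sub_div, ← sub_mul, abs_div, abs_mul, abs_of_pos hs, abs_of_pos hD0,
      div_le_one hs] at h1
    rwa [le_div_iff₀ hD0]
  have hFd : ∀ p, Metric.ediam (F p) ≤ ENNReal.ofReal s := by
    intro p
    refine Metric.ediam_le fun x hx y hy => ?_
    rw [edist_dist]
    refine ENNReal.ofReal_le_ofReal ?_
    have key : ∀ i, |x i - y i| ≤ s / D := by
      intro i
      apply hcell
      rcases Fin.eq_self_or_eq_succAbove p.1 i with rfl | ⟨j, rfl⟩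
      · rw [hx.1, hy.1]
      · rw [hx.2 j, hy.2 j]
    refine (EuclideanSpace.dist_le_card_mul (by positivity) key).trans_eq ?_
    push_cast
    rw [← hD]
    field_simp
  have hcov : gridSlab (m + 1) δ R s ⊆ ⋃ p, F p := by
    rintro x ⟨hxR, i, k, hk⟩
    have hxj : ∀ j, |x j| ≤ R := fun j => (PiLp.norm_apply_le x j).trans hxR
    have hkM : k ∈ Finset.Icc (-M) M := by
      have h1 : |(k : ℝ)| ≤ (R + 2) / δ := by
        rw [le_div_iff₀ hδ]
        have h2 : |(k : ℝ) * δ| = |(k : ℝ)| * δ := by rw [abs_mul, abs_of_pos hδ]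
        rw [← h2]
        have := abs_sub_abs_le_abs_sub ((k : ℝ) * δ) (x i)
        rw [abs_sub_comm] at this
        linarith [hxj i]
      have h2 : |(k : ℝ)| ≤ M := h1.trans (Int.le_ceil _)
      rw [Finset.mem_Icc, ← abs_le]
      exact_mod_cast h2
    have heN : ⌊x i * D / s⌋ - ⌊(k : ℝ) * δ * D / s⌋ ∈ Finset.Icc (-N) N := by
      have h1 : |x i * D / s - (k : ℝ) * δ * D / s| ≤ 2 * D := by
        rw [← sub_div, ← sub_mul, abs_div, abs_mul, abs_of_pos hs, abs_of_pos hD0,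
          div_le_iff₀ hs]
        nlinarith
      rw [abs_le] at h1
      have a1 := Int.floor_le (x i * D / s)
      have a2 := Int.lt_floor_add_one (x i * D / s)
      have b1 := Int.floor_le ((k : ℝ) * δ * D / s)
      have b2 := Int.lt_floor_add_one ((k : ℝ) * δ * D / s)
      have hN' : (N : ℝ) = 2 * D + 1 := by rw [hN, hD]; push_cast; ring
      rw [Finset.mem_Icc]
      constructor
      · have : (-N : ℝ) ≤ ⌊x i * D / s⌋ - ⌊(k : ℝ) * δ * D / s⌋ := by linarith
        exact_mod_cast this
      · have : (⌊x i * D / s⌋ - ⌊(k : ℝ) * δ * D / s⌋ : ℝ) ≤ N := by linarith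
        exact_mod_cast this
    have hjL : ∀ j, ⌊x j * D / s⌋ ∈ Finset.Icc (-L) L := by
      intro j
      have h1 : |x j * D / s| ≤ R * D / s := by
        rw [abs_div, abs_mul, abs_of_pos hs, abs_of_pos hD0]
        gcongr
        exact hxj j
      rw [abs_le] at h1
      have a1 := Int.floor_le (x j * D / s)
      have a2 := Int.lt_floor_add_one (x j * D / s)
      have hc := Int.le_ceil (R * D / s)
      have hL' : (L : ℝ) = ⌈R * D / s⌉ + 1 := by rw [hL]; push_cast; ring
      rw [Finset.mem_Icc]
      constructor
      · have : (-L : ℝ) ≤ ⌊x j * D / s⌋ := by linarith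
        exact_mod_cast this
      · have : (⌊x j * D / s⌋ : ℝ) ≤ L := by linarith
        exact_mod_cast this
    refine mem_iUnion.2 ⟨(i, (⟨k, hkM⟩, ⟨_, heN⟩), fun j => ⟨_, hjL (i.succAbove j)⟩), ?_, ?_⟩
    · simp
    · intro j
      rfl
  refine (coverNum_le_card F hFd hcov).trans ?_
  rw [← ENNReal.ofReal_natCast]
  refine ENNReal.ofReal_le_ofReal ?_
  have hcard : ∀ K : ℤ, 0 ≤ K → ((Finset.Icc (-K) K).card : ℝ) = 2 * K + 1 := by
    intro K hK
    have : ((Finset.Icc (-K) K).card : ℤ) = 2 * K + 1 := by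
      rw [Int.card_Icc, Int.toNat_of_nonneg (by omega)]
      ring
    exact_mod_cast this
  have hN0 : 0 ≤ N := by omega
  have hMr : (0 : ℝ) ≤ M := by exact_mod_cast hM0
  have hNr : (0 : ℝ) ≤ N := by exact_mod_cast hN0
  have hLr : (0 : ℝ) ≤ L := by exact_mod_cast hL0
  have hLs : 2 * (L : ℝ) + 1 ≤ (2 * R * D + 5) * s⁻¹ := by
    have hc := (Int.ceil_lt_add_one (R * D / s)).le
    have hL' : (L : ℝ) = ⌈R * D / s⌉ + 1 := by rw [hL]; push_cast; ring
    have h1 : 1 ≤ s⁻¹ := (one_le_inv₀ hs).2 hs1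
    rw [div_eq_mul_inv] at hc
    rw [hL', div_eq_mul_inv]
    linarith
  simp only [ι, Fintype.card_prod, Fintype.card_fin, Fintype.card_pi, Fintype.card_coe,
    Finset.prod_const, Finset.card_univ, Nat.cast_mul, Nat.cast_pow, hcard M hM0, hcard N hN0,
    hcard L hL0]
  push_cast
  rw [mul_assoc (((m : ℝ) + 1) * _), ← mul_pow, mul_assoc ((m : ℝ) + 1)]
  gcongr

lemma eventually_coverNum_gridSlab_le (m : ℕ) {δ R ε : ℝ} (hδ : 0 < δ) (hR : 0 < R)
    (hε : 0 < ε) :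
    ∀ᶠ s in 𝓝[>] (0 : ℝ), coverNum s (gridSlab (m + 1) δ R s)
      ≤ ENNReal.ofReal (s⁻¹ ^ ((m : ℝ) + ε)) := by
  obtain ⟨C, hC, h⟩ := coverNum_gridSlab_le m hδ hR
  have ht : ∀ᶠ s in 𝓝[>] (0 : ℝ), C ≤ s⁻¹ ^ ε :=
    ((tendsto_rpow_atTop hε).comp tendsto_inv_nhdsGT_zero).eventually_ge_atTop C
  filter_upwards [ht, Ioo_mem_nhdsGT (zero_lt_one (α := ℝ))] with s hs hs01
  refine (h s hs01.1 hs01.2.le).trans (ENNReal.ofReal_le_ofReal ?_)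
  have hs0 : 0 < s⁻¹ := inv_pos.2 hs01.1
  rw [Real.rpow_add hs0, Real.rpow_natCast, mul_comm]
  gcongr

lemma log_coverNum_mul_le {X : Type*} [PseudoMetricSpace X] {E : Set X} {s c : ℝ} (hs : 0 < s)
    (hs1 : s < 1) (h : coverNum s E ≤ ENNReal.ofReal (s⁻¹ ^ c)) :
    ENNReal.log (coverNum s E) * ((|Real.log s|⁻¹ : ℝ) : EReal) ≤ c := by
  have hs0 : 0 < s⁻¹ := inv_pos.2 hs
  have hlog : Real.log s < 0 := Real.log_neg hs hs1
  have h1 : ENNReal.log (coverNum s E) ≤ ((c * |Real.log s| : ℝ) : EReal) := by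
    refine (ENNReal.log_monotone h).trans_eq ?_
    rw [ENNReal.log_ofReal_of_pos (Real.rpow_pos_of_pos hs0 c), Real.log_rpow hs0, Real.log_inv,
      abs_of_neg hlog]
  refine (mul_le_mul_of_nonneg_right h1 (EReal.coe_nonneg.2 (by positivity))).trans_eq ?_
  rw [← EReal.coe_mul, mul_assoc, mul_inv_cancel₀ (abs_pos.2 hlog.ne).ne', mul_one]

/-- A continuous staircase: equal to `δ * ⌊t / δ⌋` away from `δ * ℤ`, with ramps of width
smaller than `s`. -/
noncomputable def staircase (δ s t : ℝ) : ℝ :=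
  t - δ * min (Int.fract (t / δ)) (δ / s * (1 - Int.fract (t / δ)))

lemma continuous_staircase {δ s : ℝ} (hδ : 0 < δ) (hs : 0 < s) : Continuous (staircase δ s) := by
  have hw : Continuous fun p : ℝ × ℝ => min p.2 (δ / s * (1 - p.2)) := by fun_prop
  have h : Continuous fun t : ℝ => min (Int.fract (t / δ)) (δ / s * (1 - Int.fract (t / δ))) := by
    refine ContinuousOn.comp_fract (s := fun t : ℝ => t / δ)
      (f := fun _ u : ℝ => min u (δ / s * (1 - u))) hw.continuousOn
      (continuous_id.div_const δ) fun _ => ?_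
    have : 0 ≤ δ / s := by positivity
    simp [this]
  exact continuous_id.sub (continuous_const.mul h)

lemma abs_staircase_sub_le {δ s : ℝ} (hδ : 0 < δ) (hs : 0 < s) (t : ℝ) :
    |staircase δ s t - t| ≤ δ := by
  have h0 := Int.fract_nonneg (t / δ)
  have h1 := (Int.fract_lt_one (t / δ)).le
  have h2 : 0 ≤ min (Int.fract (t / δ)) (δ / s * (1 - Int.fract (t / δ))) :=
    le_min h0 (mul_nonneg (by positivity) (by linarith))
  have h3 := (min_le_left (Int.fract (t / δ)) (δ / s * (1 - Int.fract (t / δ)))).trans h1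
  rw [staircase, sub_sub_cancel_left, abs_neg, abs_of_nonneg (by positivity)]
  exact mul_le_of_le_one_right hδ.le h3

lemma staircase_eq_of_forall_lt {δ s t t' : ℝ} (hδ : 0 < δ) (hs : 0 < s)
    (ht : ∀ k : ℤ, 2 * s < |t - k * δ|) (htt' : |t' - t| ≤ s) :
    staircase δ s t' = δ * ⌊t / δ⌋ := by
  have a1 := Int.floor_le (t / δ)
  have a2 := Int.lt_floor_add_one (t / δ)
  rw [le_div_iff₀ hδ] at a1
  rw [div_lt_iff₀ hδ] at a2
  have b1 := ht ⌊t / δ⌋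
  have b2 := ht (⌊t / δ⌋ + 1)
  push_cast at b2
  rw [abs_of_nonneg (by linarith)] at b1
  rw [abs_of_nonpos (by linarith)] at b2
  rw [abs_le] at htt'
  have hfl : ⌊t' / δ⌋ = ⌊t / δ⌋ := by
    rw [Int.floor_eq_iff, le_div_iff₀ hδ, div_lt_iff₀ hδ]
    constructor <;> linarith
  have hfr : Int.fract (t' / δ) = t' / δ - ⌊t / δ⌋ := by rw [← hfl]; rfl
  have h1 : s / δ ≤ 1 - Int.fract (t' / δ) := by
    rw [hfr, div_le_iff₀ hδ]
    have : (1 - (t' / δ - ⌊t / δ⌋)) * δ = δ + ⌊t / δ⌋ * δ - t' := by field_simp; ring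
    linarith
  have h2 : 1 ≤ δ / s * (1 - Int.fract (t' / δ)) := by
    calc (1 : ℝ) = δ / s * (s / δ) := by field_simp
      _ ≤ _ := by gcongr
  rw [staircase, min_eq_left ((Int.fract_lt_one _).le.trans h2), hfr]
  field_simp
  ring

lemma exists_continuous_eqOn_of_isCompact {E : Type*} [TopologicalSpace E] [NormalSpace E]
    [T2Space E] {Ω : Set E} (f : C(Ω, ℝ)) {K : Set Ω} (hK : IsCompact K) :
    ∃ F : C(E, ℝ), ∀ x ∈ K, F x = f x := by
  have : CompactSpace K := isCompact_iff_compactSpace.1 hK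
  have he : IsClosedEmbedding (fun x : K => ((x : Ω) : E)) :=
    (continuous_subtype_val.comp continuous_subtype_val).isClosedEmbedding
      (Subtype.val_injective.comp Subtype.val_injective)
  obtain ⟨F, hF⟩ := ContinuousMap.exists_extension he (f.restrict K)
  exact ⟨F, fun x hx => DFunLike.congr_fun hF ⟨x, hx⟩⟩

lemma exists_pos_dist_lt_subset_of_mem_nhds {X : Type*} [TopologicalSpace X] {f : C(X, ℝ)}
    {V : Set C(X, ℝ)} (hV : V ∈ 𝓝 f) :
    ∃ K : Set X, IsCompact K ∧ ∃ ε : ℝ, 0 < ε ∧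
      {g : C(X, ℝ) | ∀ x ∈ K, dist (f x) (g x) < ε} ⊆ V := by
  obtain ⟨W, hW, hWV⟩ := UniformSpace.mem_nhds_iff.1 hV
  obtain ⟨K, U, hK, hU, hKU⟩ := (ContinuousMap.mem_compactConvergence_entourage_iff W).1 hW
  obtain ⟨ε, hε, hεU⟩ := Metric.mem_uniformity_dist.1 hU
  exact ⟨K, hK, ε, hε, fun g hg => hWV (@hKU (f, g) fun x hx => hεU (hg x hx))⟩

lemma setOf_dist_lt_mem_nhds {X : Type*} [TopologicalSpace X] (f : C(X, ℝ)) {K : Set X}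
    (hK : IsCompact K) {ε : ℝ} (hε : 0 < ε) :
    {g : C(X, ℝ) | ∀ x ∈ K, dist (f x) (g x) < ε} ∈ 𝓝 f :=
  UniformSpace.mem_nhds_iff.2 ⟨_, (ContinuousMap.mem_compactConvergence_entourage_iff _).2
    ⟨K, _, hK, Metric.dist_mem_uniformity hε, Subset.rfl⟩, fun _ hg => hg⟩

/-- On `K`, off a set covered by few sets of diameter `s`, the function `f` oscillates by at most
`ε * φ s` at the scale `s`. -/
def SmallOscillationOn {n : ℕ} {Ω : Set (EuclideanSpace ℝ (Fin n))} (φ : ℝ → ℝ) (c ε : ℝ)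
    (K : Set Ω) (f : Ω → ℝ) : Prop :=
  ∃ s : ℝ, 0 < s ∧ s < ε ∧ s < 1 ∧ ∃ S : Set (EuclideanSpace ℝ (Fin n)),
    coverNum s S ≤ ENNReal.ofReal (s⁻¹ ^ (c + ε)) ∧
    ∀ x ∈ K, (x : EuclideanSpace ℝ (Fin n)) ∉ S →
      Metric.ediam (f '' Metric.closedBall x s) ≤ ENNReal.ofReal (ε * φ s)

lemma setOf_smallOscillationOn_mem_residual {m : ℕ} {Ω : Set (EuclideanSpace ℝ (Fin (m + 1)))}
    {φ : ℝ → ℝ} (hφ : ∀ r, 0 < r → 0 < φ r) {ε : ℝ} (hε : 0 < ε) {K K' : Set Ω}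
    (hK : IsCompact K) (hK' : IsCompact K') (hKK' : K ⊆ interior K') :
    {f : C(Ω, ℝ) | SmallOscillationOn φ m ε K f} ∈ residual C(Ω, ℝ) := by
  refine mem_of_superset (residual_of_dense_open isOpen_interior ?_) interior_subset
  rw [dense_iff_inter_open]
  rintro V hVo ⟨f₀, hf₀⟩
  obtain ⟨A, hA, η, hη, hAV⟩ := exists_pos_dist_lt_subset_of_mem_nhds (hVo.mem_nhds hf₀)
  obtain ⟨F, hF⟩ := exists_continuous_eqOn_of_isCompact f₀ hA
  obtain ⟨ρ, hρ, hρF⟩ := Metric.mem_uniformity_dist.1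
    ((hA.image continuous_subtype_val).uniformContinuousAt_of_continuousAt F
      (fun a _ => F.continuous.continuousAt) (Metric.dist_mem_uniformity hη))
  set δ : ℝ := ρ / (2 * (m + 1)) with hδ_def
  have hδ : 0 < δ := by positivity
  obtain ⟨R, hR, hKR⟩ : ∃ R : ℝ, 0 < R ∧ ∀ x ∈ K, ‖(x : EuclideanSpace ℝ (Fin (m + 1)))‖ ≤ R := by
    obtain ⟨R, hR, h⟩ := (hK.image continuous_subtype_val).isBounded.exists_pos_norm_le
    exact ⟨R, hR, fun x hx => h x (mem_image_of_mem _ hx)⟩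
  obtain ⟨τ, hτ, hτK⟩ := hK.exists_cthickening_subset_open isOpen_interior hKK'
  obtain ⟨s, hs_cover, hs0, hs⟩ := ((eventually_coverNum_gridSlab_le m hδ hR hε).and
    (Ioo_mem_nhdsGT (lt_min (lt_min hε one_pos) hτ))).exists
  have hsε : s < ε := hs.trans_le ((min_le_left _ _).trans (min_le_left _ _))
  have hs1 : s < 1 := hs.trans_le ((min_le_left _ _).trans (min_le_right _ _))
  have hsτ : s < τ := hs.trans_le (min_le_right _ _)
  let P : EuclideanSpace ℝ (Fin (m + 1)) → EuclideanSpace ℝ (Fin (m + 1)) :=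
    fun x => WithLp.toLp 2 fun i => staircase δ s (x i)
  have hP : Continuous P := by
    have := continuous_staircase hδ hs0
    fun_prop
  let g : C(Ω, ℝ) := ⟨fun x => F (P x), F.continuous.comp (hP.comp continuous_subtype_val)⟩
  refine ⟨g, hAV fun x hx => ?_, ?_⟩
  · rw [← hF x hx]
    refine hρF ?_ (mem_image_of_mem _ hx)
    have h := EuclideanSpace.dist_le_card_mul (x := P x) (y := x) hδ.le
      fun i => abs_staircase_sub_le hδ hs0 _
    rw [dist_comm]
    refine h.trans_lt ?_
    rw [hδ_def]
    push_cast
    field_simp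
    norm_num
  rw [mem_interior_iff_mem_nhds]
  have hφs := hφ s hs0
  refine mem_of_superset (setOf_dist_lt_mem_nhds g hK' (half_pos (mul_pos hε hφs))) fun h hh => ?_
  refine ⟨s, hs0, hsε, hs1, _, hs_cover, fun x hx hxS => Metric.ediam_le ?_⟩
  have hxK' : Metric.closedBall x s ⊆ K' :=
    (Metric.closedBall_subset_closedBall hsτ.le).trans
      ((Metric.closedBall_subset_cthickening hx τ).trans (hτK.trans interior_subset))
  have hgrid : ∀ i, ∀ k : ℤ, 2 * s < |(x : EuclideanSpace ℝ (Fin (m + 1))) i - k * δ| := by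
    intro i k
    by_contra! hik
    exact hxS ⟨hKR x hx, i, k, hik⟩
  have hgx : ∀ y ∈ Metric.closedBall x s,
      g y = F (WithLp.toLp 2 fun i => δ * ⌊(x : EuclideanSpace ℝ (Fin (m + 1))) i / δ⌋) := by
    intro y hy
    change F (WithLp.toLp 2 fun i => staircase δ s _) = _
    congr 2
    funext i
    refine staircase_eq_of_forall_lt hδ hs0 (hgrid i) ?_
    refine (PiLp.norm_apply_le ((y : EuclideanSpace ℝ (Fin (m + 1))) - (x : EuclideanSpace ℝ (Fin (m + 1)))) i).trans ?_
    rw [← dist_eq_norm]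
    exact hy
  rintro _ ⟨y, hy, rfl⟩ _ ⟨z, hz, rfl⟩
  rw [edist_dist]
  refine ENNReal.ofReal_le_ofReal ?_
  have h1 := hh y (hxK' hy)
  have h2 := hh z (hxK' hz)
  rw [hgx y hy] at h1
  rw [hgx z hz] at h2
  linarith [dist_triangle_left (h y) (h z)
    (F (WithLp.toLp 2 fun i => δ * ⌊(x : EuclideanSpace ℝ (Fin (m + 1))) i / δ⌋))]

lemma lbdim_le_of_forall_exists {X : Type*} [PseudoMetricSpace X] {E : Set X} {c : ℝ}
    (h : ∀ ε : ℝ, 0 < ε → ∃ s : ℝ, 0 < s ∧ s < ε ∧ s < 1 ∧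
      coverNum s E ≤ ENNReal.ofReal (s⁻¹ ^ (c + ε))) : lbdim E ≤ c := by
  rw [← EReal.le_of_forall_lt_iff_le]
  intro z hz
  rw [EReal.coe_lt_coe_iff] at hz
  refine liminf_le_of_frequently_le' ?_
  rw [(nhdsGT_basis (0 : ℝ)).frequently_iff]
  intro a ha
  obtain ⟨s, hs0, hsε, hs1, hs⟩ := h (min a (z - c)) (lt_min ha (sub_pos.2 hz))
  refine ⟨s, ⟨hs0, hsε.trans_le (min_le_left _ _)⟩, (log_coverNum_mul_le hs0 hs1 hs).trans ?_⟩
  rw [EReal.coe_le_coe_iff]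
  linarith [min_le_right a (z - c)]

lemma lipGauge_eq_zero_of_forall_exists {X : Type*} [PseudoMetricSpace X] {φ : ℝ → ℝ}
    (hφ : ∀ r, 0 < r → 0 < φ r) {f : X → ℝ} {x : X}
    (h : ∀ ε : ℝ, 0 < ε → ∃ s : ℝ, 0 < s ∧ s < ε ∧
      Metric.ediam (f '' Metric.closedBall x s) ≤ ENNReal.ofReal (ε * φ s)) :
    lipGauge φ f x = 0 := by
  refine le_antisymm (ENNReal.le_of_forall_pos_le_add fun c hc _ => ?_) bot_le
  rw [zero_add]
  refine liminf_le_of_frequently_le' ?_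
  rw [(nhdsGT_basis (0 : ℝ)).frequently_iff]
  intro a ha
  obtain ⟨s, hs0, hsε, hs⟩ := h (min a c) (lt_min ha (NNReal.coe_pos.2 hc))
  refine ⟨s, ⟨hs0, hsε.trans_le (min_le_left _ _)⟩, ?_⟩
  have hφs := hφ s hs0
  refine ENNReal.div_le_of_le_mul (hs.trans ?_)
  rw [← ENNReal.ofReal_coe_nnreal, ← ENNReal.ofReal_mul c.coe_nonneg]
  refine ENNReal.ofReal_le_ofReal ?_
  gcongr
  exact min_le_right _ _

lemma SmallOscillationOn.lpdim_le {n : ℕ} {Ω : Set (EuclideanSpace ℝ (Fin n))} {φ : ℝ → ℝ}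
    (hφ : ∀ r, 0 < r → 0 < φ r) {c : ℝ} {K : ℕ → Set Ω} (hK : Monotone K)
    (hKΩ : ⋃ k, K k = univ) {f : Ω → ℝ}
    (h : ∀ k : ℕ, SmallOscillationOn φ c (1 / ((k : ℝ) + 1)) (K k) f) :
    lpdim {x : EuclideanSpace ℝ (Fin n) | ∃ hx : x ∈ Ω, 0 < lipGauge φ f ⟨x, hx⟩} ≤ c := by
  choose s hs0 hsε hs1 S hS hSK using h
  have hmono : ∀ {j k : ℕ}, j ≤ k → 1 / ((k : ℝ) + 1) ≤ 1 / ((j : ℝ) + 1) := fun hjk =>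
    Nat.one_div_le_one_div hjk
  refine (iInf₂_le (fun j => {x | ∀ k ≥ j, x ∈ S k}) ?_).trans (iSup_le fun j => ?_)
  · rintro x ⟨hx, hpos⟩
    by_contra hxS
    simp only [mem_iUnion, mem_ofPred_eq, not_exists, not_forall] at hxS
    obtain ⟨k₀, hk₀⟩ := mem_iUnion.1 (hKΩ.ge (mem_univ (⟨x, hx⟩ : Ω)))
    refine hpos.ne' (lipGauge_eq_zero_of_forall_exists hφ fun ε hε => ?_)
    obtain ⟨j, hj⟩ := exists_nat_one_div_lt hε
    obtain ⟨k, hk, hxk⟩ := hxS (max j k₀)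
    have hkε := (hmono ((le_max_left j k₀).trans hk)).trans hj.le
    refine ⟨s k, hs0 k, (hsε k).trans_le hkε,
      (hSK k _ (hK ((le_max_right j k₀).trans hk) hk₀) hxk).trans ?_⟩
    exact ENNReal.ofReal_le_ofReal (mul_le_mul_of_nonneg_right hkε (hφ _ (hs0 k)).le)
  · refine lbdim_le_of_forall_exists fun ε hε => ?_
    obtain ⟨i, hi⟩ := exists_nat_one_div_lt hε
    have hkε := (hmono (le_max_left i j)).trans hi.le
    refine ⟨s (max i j), hs0 _, (hsε _).trans_le hkε, hs1 _,
      (coverNum_mono (E' := S (max i j)) fun x (hx : ∀ k ≥ j, x ∈ S k) =>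
        hx _ (le_max_right i j)).trans ((hS _).trans ?_)⟩
    exact ENNReal.ofReal_le_ofReal (Real.rpow_le_rpow_of_exponent_le
      ((one_le_inv₀ (hs0 _)).2 (hs1 _).le) (by linarith))

theorem stmt2
    (d : ℕ) (hd : 0 < d) (Ω : Set (EuclideanSpace ℝ (Fin d)))
    (hΩ : LocallyCompactSpace Ω) (φ : ℝ → ℝ) (hφ : IsGauge φ) :
    ∀ᶠ f : C(↥Ω, ℝ) in residual C(↥Ω, ℝ),
      lpdim {x : EuclideanSpace ℝ (Fin d) | ∃ hx : x ∈ Ω, 0 < lipGauge φ (⇑f) ⟨x, hx⟩}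
        ≤ ((d - 1 : ℕ) : EReal) := by
  obtain ⟨m, rfl⟩ : ∃ m, d = m + 1 := ⟨d - 1, by omega⟩
  let K : CompactExhaustion Ω := default
  have hres : ∀ k : ℕ, ∀ᶠ f : C(Ω, ℝ) in residual C(Ω, ℝ),
      SmallOscillationOn φ m (1 / ((k : ℝ) + 1)) (K k) f := fun k =>
    setOf_smallOscillationOn_mem_residual hφ.2.2.2 (by positivity) (K.isCompact k)
      (K.isCompact (k + 1)) (K.subset_interior_succ k)
  filter_upwards [eventually_countable_forall.2 hres] with f hf
  have hK : Monotone fun k => K k := fun _ _ h => K.subset h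
  simpa using SmallOscillationOn.lpdim_le hφ.2.2.2 hK K.iUnion_eq hf
end
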